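/- arXiv:1202.3463 — 2 statements merged into one kernel-verified Lean document; each statement's English description precedes it below -/
import Mathlib

section
/- For all integers m ≥ 1 and k ≥ 1, the composite of η'_{2k−1} with the projection L'_1 ⊗ L'_{2k} → L_1 ⊗ L_{2k} vanishes on every boundary-twist relator ⟨(i,J),J⟩, and the induced homomorphism η_{2k−1} : 𝒯^∞_{2k−1} → L_1 ⊗ L_{2k} is injective with image exactly D_{2k−1}; in particular 𝒯^∞_{2k−1} ≅ D_{2k−1}. -/
open scoped TensorProduct

/-- Rooted binary trees (formal non-associative bracket monomials) with
leaves labeled in `Fin m`.  The degree is the number of leaves, the order is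
the degree minus one. -/
inductive RTree (m : ℕ) : Type
  | leaf : Fin m → RTree m
  | node : RTree m → RTree m → RTree m

namespace RTree

/-- The degree of a rooted tree = its number of leaves. -/
def deg {m : ℕ} : RTree m → ℕ
  | leaf _ => 1
  | node a b => deg a + deg b

end RTree

/-- One-hole contexts for rooted trees. -/
inductive Ctx (m : ℕ) : Type
  | hole : Ctx m
  | nodeL : Ctx m → RTree m → Ctx m
  | nodeR : RTree m → Ctx m → Ctx m

/-- Fill the hole of a context with a rooted tree. -/
def Ctx.fill {m : ℕ} : Ctx m → RTree m → RTree m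
  | .hole, t => t
  | .nodeL c r, t => RTree.node (c.fill t) r
  | .nodeR l c, t => RTree.node l (c.fill t)

/-- Relators presenting the degree `n` part `L'_n` of the free quasi-Lie ring:
generators of the wrong degree are killed, and antisymmetry and Jacobi
relators are imposed at every position (one-hole context). -/
def quasiLieRels (m n : ℕ) : Set (FreeAbelianGroup (RTree m)) :=
  {x | ∃ J : RTree m, J.deg ≠ n ∧ x = FreeAbelianGroup.of J} ∪
  {x | ∃ (c : Ctx m) (A B : RTree m),
      x = FreeAbelianGroup.of (c.fill (RTree.node A B)) +
          FreeAbelianGroup.of (c.fill (RTree.node B A))} ∪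
  {x | ∃ (c : Ctx m) (A B C : RTree m),
      x = FreeAbelianGroup.of (c.fill (RTree.node A (RTree.node B C))) -
          FreeAbelianGroup.of (c.fill (RTree.node (RTree.node A B) C)) -
          FreeAbelianGroup.of (c.fill (RTree.node B (RTree.node A C)))}

/-- `L'_n`, the degree `n` part of Levine's free quasi-Lie ring on `X_1,…,X_m`. -/
abbrev Lp (m n : ℕ) :=
  FreeAbelianGroup (RTree m) ⧸ AddSubgroup.closure (quasiLieRels m n)

/-- The canonical projection onto `L'_n`. -/
abbrev LpMk (m n : ℕ) : FreeAbelianGroup (RTree m) →+ Lp m n :=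
  QuotientAddGroup.mk' _

/-- Relators for the free Lie ring: additionally kill all squares `[J,J]`
(at every position). -/
def lieRels (m n : ℕ) : Set (FreeAbelianGroup (RTree m)) :=
  quasiLieRels m n ∪
  {x | ∃ (c : Ctx m) (J : RTree m), x = FreeAbelianGroup.of (c.fill (RTree.node J J))}

/-- `L_n`, the degree `n` part of the free Lie ring on `X_1,…,X_m` over `ℤ`. -/
abbrev LL (m n : ℕ) :=
  FreeAbelianGroup (RTree m) ⧸ AddSubgroup.closure (lieRels m n)

/-- The canonical projection onto `L_n`. -/
abbrev LLMk (m n : ℕ) : FreeAbelianGroup (RTree m) →+ LL m n :=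
  QuotientAddGroup.mk' _

/-- The canonical projection `L'_n → L_n`. -/
def LpToLL (m n : ℕ) : Lp m n →+ LL m n :=
  QuotientAddGroup.map _ _ (AddMonoidHom.id _)
    (by
      rw [AddSubgroup.comap_id]
      exact AddSubgroup.closure_mono Set.subset_union_left)

/-- Free-level bracketing `t ↦ [X i, t]` with a degree one generator. -/
def brLeafFree (m : ℕ) (i : Fin m) :
    FreeAbelianGroup (RTree m) →+ FreeAbelianGroup (RTree m) :=
  FreeAbelianGroup.lift fun t => FreeAbelianGroup.of (RTree.node (RTree.leaf i) t)

theorem brLeafFree_mem_quasi {m n : ℕ} (i : Fin m) {x : FreeAbelianGroup (RTree m)}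
    (hx : x ∈ quasiLieRels m n) :
    brLeafFree m i x ∈ AddSubgroup.closure (quasiLieRels m (n + 1)) := by
  apply AddSubgroup.subset_closure
  rcases hx with (⟨J, hJ, rfl⟩ | ⟨c, A, B, rfl⟩) | ⟨c, A, B, C, rfl⟩
  · refine Or.inl (Or.inl ⟨RTree.node (RTree.leaf i) J, ?_, ?_⟩)
    · simp only [RTree.deg]; omega
    · simp [brLeafFree]
  · refine Or.inl (Or.inr ⟨Ctx.nodeR (RTree.leaf i) c, A, B, ?_⟩)
    simp [brLeafFree, Ctx.fill]
  · refine Or.inr ⟨Ctx.nodeR (RTree.leaf i) c, A, B, C, ?_⟩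
    simp [brLeafFree, Ctx.fill]

theorem brLeafFree_closure_quasi {m n : ℕ} (i : Fin m) :
    AddSubgroup.closure (quasiLieRels m n) ≤
      (AddSubgroup.closure (quasiLieRels m (n + 1))).comap (brLeafFree m i) :=
  (AddSubgroup.closure_le _).2 fun _x hx =>
    AddSubgroup.mem_comap.2 (brLeafFree_mem_quasi i hx)

/-- Bracketing `[X_i, ·] : L'_n → L'_{n+1}` with a degree one generator. -/
def brLeaf (m n : ℕ) (i : Fin m) : Lp m n →+ Lp m (n + 1) :=
  QuotientAddGroup.map _ _ (brLeafFree m i) (brLeafFree_closure_quasi i)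

theorem brLeafFree_mem_lie {m n : ℕ} (i : Fin m) {x : FreeAbelianGroup (RTree m)}
    (hx : x ∈ lieRels m n) :
    brLeafFree m i x ∈ AddSubgroup.closure (lieRels m (n + 1)) := by
  apply AddSubgroup.subset_closure
  rcases hx with ((⟨J, hJ, rfl⟩ | ⟨c, A, B, rfl⟩) | ⟨c, A, B, C, rfl⟩) | ⟨c, J, rfl⟩
  · refine Or.inl (Or.inl (Or.inl ⟨RTree.node (RTree.leaf i) J, ?_, ?_⟩))
    · simp only [RTree.deg]; omega
    · simp [brLeafFree]
  · exact Or.inl (Or.inl (Or.inr ⟨Ctx.nodeR (RTree.leaf i) c, A, B, by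
      simp [brLeafFree, Ctx.fill]⟩))
  · exact Or.inl (Or.inr ⟨Ctx.nodeR (RTree.leaf i) c, A, B, C, by
      simp [brLeafFree, Ctx.fill]⟩)
  · exact Or.inr ⟨Ctx.nodeR (RTree.leaf i) c, J, by simp [brLeafFree, Ctx.fill]⟩

theorem brLeafFree_closure_lie {m n : ℕ} (i : Fin m) :
    AddSubgroup.closure (lieRels m n) ≤
      (AddSubgroup.closure (lieRels m (n + 1))).comap (brLeafFree m i) :=
  (AddSubgroup.closure_le _).2 fun _x hx =>
    AddSubgroup.mem_comap.2 (brLeafFree_mem_lie i hx)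

/-- Bracketing `[X_i, ·] : L_n → L_{n+1}` with a degree one generator. -/
def brLeafL (m n : ℕ) (i : Fin m) : LL m n →+ LL m (n + 1) :=
  QuotientAddGroup.map _ _ (brLeafFree m i) (brLeafFree_closure_lie i)

/-- The bracket map `L'_1 ⊗ L'_a → L'_{a+1}`, `X_i ⊗ Y ↦ [X_i, Y]`,
where `L'_1 = L_1 ≅ ℤ^m` is realized as `FreeAbelianGroup (Fin m)` with basis `X_i`.
The kernel of `bracketLp m (n+1)` is the group `D'_n`. -/
noncomputable def bracketLp (m a : ℕ) :
    (FreeAbelianGroup (Fin m)) ⊗[ℤ] (Lp m a) →ₗ[ℤ] Lp m (a + 1) :=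
  TensorProduct.lift
    ((FreeAbelianGroup.lift fun i => (brLeaf m a i).toIntLinearMap).toIntLinearMap)

/-- The bracket map `L_1 ⊗ L_a → L_{a+1}`.  The kernel of `bracketLL m (n+1)` is `D_n`. -/
noncomputable def bracketLL (m a : ℕ) :
    (FreeAbelianGroup (Fin m)) ⊗[ℤ] (LL m a) →ₗ[ℤ] LL m (a + 1) :=
  TensorProduct.lift
    ((FreeAbelianGroup.lift fun i => (brLeafL m a i).toIntLinearMap).toIntLinearMap)

/-- `id ⊗ proj : L_1 ⊗ L'_n → L_1 ⊗ L_n`. -/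
noncomputable def projT (m n : ℕ) :
    (FreeAbelianGroup (Fin m)) ⊗[ℤ] (Lp m n) →ₗ[ℤ]
      (FreeAbelianGroup (Fin m)) ⊗[ℤ] (LL m n) :=
  LinearMap.lTensor _ (LpToLL m n).toIntLinearMap

/-- Given a rooted tree `t` and a rooted tree `rest` (representing the rest of the
unrooted tree `⟨t, rest⟩` hanging off the root edge of `t`), list, for each leaf `v`
of `t`, the label of `v` together with the rooted tree obtained from the unrooted
tree `⟨t, rest⟩` by making `v` the root. -/
def rerootList {m : ℕ} : RTree m → RTree m → List (Fin m × RTree m)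
  | RTree.leaf i, rest => [(i, rest)]
  | RTree.node a b, rest =>
      rerootList a (RTree.node b rest) ++ rerootList b (RTree.node rest a)

/-- All univalent vertices of the unrooted tree `⟨p.1, p.2⟩`, together with the
corresponding rerooted trees. -/
def pairReroots {m : ℕ} (p : RTree m × RTree m) : List (Fin m × RTree m) :=
  rerootList p.1 p.2 ++ rerootList p.2 p.1

/-- Relators presenting the order `n` tree group `𝒯_n`.  An unrooted unitrivalent
labeled vertex-oriented tree is presented as the inner product `⟨I,J⟩` of a pair of
rooted trees (cutting an edge); generators of the wrong order are killed, and we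
impose: symmetry `⟨I,J⟩ = ⟨J,I⟩`, edge-sliding `⟨(A,B),C⟩ = ⟨A,(B,C)⟩` (both of
which express that the pair presents the same unrooted tree), antisymmetry (AS),
and Jacobi (IHX) relations. -/
def treeRels (m n : ℕ) : Set (FreeAbelianGroup (RTree m × RTree m)) :=
  {x | ∃ p : RTree m × RTree m, p.1.deg + p.2.deg ≠ n + 2 ∧ x = FreeAbelianGroup.of p} ∪
  {x | ∃ I J : RTree m, x = FreeAbelianGroup.of (I, J) - FreeAbelianGroup.of (J, I)} ∪
  {x | ∃ A B C : RTree m,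
      x = FreeAbelianGroup.of (RTree.node A B, C) - FreeAbelianGroup.of (A, RTree.node B C)} ∪
  {x | ∃ A B C : RTree m,
      x = FreeAbelianGroup.of (RTree.node A B, C) + FreeAbelianGroup.of (RTree.node B A, C)} ∪
  {x | ∃ A B C D : RTree m,
      x = FreeAbelianGroup.of (RTree.node A (RTree.node B C), D)
        - FreeAbelianGroup.of (RTree.node (RTree.node A B) C, D)
        - FreeAbelianGroup.of (RTree.node B (RTree.node A C), D)}

/-- `𝒯_n`, the order `n` tree group. -/
abbrev Tgrp (m n : ℕ) :=
  FreeAbelianGroup (RTree m × RTree m) ⧸ AddSubgroup.closure (treeRels m n)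

/-- The canonical projection onto `𝒯_n`; the generator `⟨I,J⟩` is `TMk m n (.of (I,J))`. -/
abbrev TMk (m n : ℕ) : FreeAbelianGroup (RTree m × RTree m) →+ Tgrp m n :=
  QuotientAddGroup.mk' _

/-- The boundary-twist relators `⟨(i,J),J⟩` (for `J` of order `k-1`, i.e. degree `k`). -/
def btRels (m k : ℕ) : Set (FreeAbelianGroup (RTree m × RTree m)) :=
  {x | ∃ (i : Fin m) (J : RTree m), J.deg = k ∧
      x = FreeAbelianGroup.of (RTree.node (RTree.leaf i) J, J)}

/-- `𝒯^∞_{2k-1}`, the quotient of `𝒯_{2k-1}` by the boundary-twist relations. -/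
abbrev Tinfodd (m k : ℕ) :=
  FreeAbelianGroup (RTree m × RTree m) ⧸
    AddSubgroup.closure (treeRels m (2 * k - 1) ∪ btRels m k)

abbrev TinfoddMk (m k : ℕ) : FreeAbelianGroup (RTree m × RTree m) →+ Tinfodd m k :=
  QuotientAddGroup.mk' _

/-- Relators presenting `𝒯^∞_{2k}`: generators are order `2k` unrooted trees
(`Sum.inl` of a pair of rooted trees, as in `treeRels`) together with `∞`-trees
`J^∞` (`Sum.inr J`) for rooted trees `J` of order `k` (degree `k+1`).  Relations:
the relations of `𝒯_{2k}` among the non-`∞` trees, wrong-degree `∞`-generators are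
killed, the symmetry relations `(-J)^∞ = J^∞`, the twisted IHX relations
`I^∞ = H^∞ + X^∞ - ⟨H,X⟩`, and the interior-twist relations `2 J^∞ = ⟨J,J⟩`. -/
def tinfRels (m k : ℕ) : Set (FreeAbelianGroup ((RTree m × RTree m) ⊕ RTree m)) :=
  (⇑(FreeAbelianGroup.map (Sum.inl : RTree m × RTree m → (RTree m × RTree m) ⊕ RTree m)) ''
      treeRels m (2 * k)) ∪
  {x | ∃ J : RTree m, J.deg ≠ k + 1 ∧ x = FreeAbelianGroup.of (Sum.inr J)} ∪
  {x | ∃ (c : Ctx m) (A B : RTree m),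
      x = FreeAbelianGroup.of (Sum.inr (c.fill (RTree.node A B)))
        - FreeAbelianGroup.of (Sum.inr (c.fill (RTree.node B A)))} ∪
  {x | ∃ (c : Ctx m) (A B C : RTree m),
      x = FreeAbelianGroup.of (Sum.inr (c.fill (RTree.node A (RTree.node B C))))
        - FreeAbelianGroup.of (Sum.inr (c.fill (RTree.node (RTree.node A B) C)))
        - FreeAbelianGroup.of (Sum.inr (c.fill (RTree.node B (RTree.node A C))))
        + FreeAbelianGroup.of (Sum.inl (c.fill (RTree.node (RTree.node A B) C),
            c.fill (RTree.node B (RTree.node A C))))} ∪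
  {x | ∃ J : RTree m,
      x = FreeAbelianGroup.of (Sum.inr J) + FreeAbelianGroup.of (Sum.inr J)
        - FreeAbelianGroup.of (Sum.inl (J, J))}

/-- `𝒯^∞_{2k}`, the twisted tree group in even order `2k`. -/
abbrev Tinf (m k : ℕ) :=
  FreeAbelianGroup ((RTree m × RTree m) ⊕ RTree m) ⧸ AddSubgroup.closure (tinfRels m k)

abbrev TinfMk (m k : ℕ) :
    FreeAbelianGroup ((RTree m × RTree m) ⊕ RTree m) →+ Tinf m k :=
  QuotientAddGroup.mk' _

/-- The degree-guarded free-level bracket: for `s, t` rooted trees,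
`brFree m a b (of s) (of t) = of [s,t]` if `s` has degree `a` and `t` degree `b`,
and `0` otherwise.  It induces the bracket `L'_a × L'_b → L'_{a+b}`. -/
def brFree (m a b : ℕ) :
    FreeAbelianGroup (RTree m) →+
      FreeAbelianGroup (RTree m) →+ FreeAbelianGroup (RTree m) :=
  FreeAbelianGroup.lift fun s =>
    FreeAbelianGroup.lift fun t =>
      if s.deg = a ∧ t.deg = b then FreeAbelianGroup.of (RTree.node s t) else 0

namespace FreeLieAlgebra

variable {X : Type*}

theorem induction_int {P : FreeLieAlgebra ℤ X → Prop} (of : ∀ x, P (of ℤ x))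
    (zero : P 0) (add : ∀ a b, P a → P b → P (a + b)) (neg : ∀ a, P a → P (-a))
    (lie : ∀ a b, P a → P b → P ⁅a, b⁆) (a : FreeLieAlgebra ℤ X) : P a := by
  let S : AddSubgroup (FreeLieAlgebra ℤ X) :=
    { carrier := {a | P a}, zero_mem' := zero, add_mem' := fun {a b} => add a b,
      neg_mem' := fun {a} => neg a }
  let S' : LieSubalgebra ℤ (FreeLieAlgebra ℤ X) :=
    { carrier := {a | P a}, zero_mem' := zero, add_mem' := fun {a b} => add a b,
      smul_mem' := fun n a ha => S.zsmul_mem ha n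
      lie_mem' := fun {a b} => lie a b }
  let j : FreeLieAlgebra ℤ X →ₗ⁅ℤ⁆ S' := lift ℤ fun x => ⟨FreeLieAlgebra.of ℤ x, of x⟩
  have h : S'.incl.comp j = LieHom.id := by
    apply hom_ext
    intro x
    exact congrArg Subtype.val
      (lift_of_apply (fun x => (⟨FreeLieAlgebra.of ℤ x, of x⟩ : S')) x)
  have h2 : (j a : FreeLieAlgebra ℤ X) = a := DFunLike.congr_fun h a
  rw [← h2]
  exact (j a).2

/-- The universal property, for a Lie bracket given as unbundled data. -/
theorem exists_lift {G : Type*} [AddCommGroup G] (br : G → G → G)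
    (add_br : ∀ x y z, br (x + y) z = br x z + br y z)
    (br_add : ∀ x y z, br x (y + z) = br x y + br x z)
    (br_self : ∀ x, br x x = 0)
    (leibniz : ∀ x y z, br x (br y z) = br (br x y) z + br y (br x z)) (f : X → G) :
    ∃ φ : FreeLieAlgebra ℤ X →+ G,
      (∀ x, φ (of ℤ x) = f x) ∧ ∀ a b, φ ⁅a, b⁆ = br (φ a) (φ b) := by
  let _ : LieRing G :=
    { bracket := br, add_lie := add_br, lie_add := br_add, lie_self := br_self,
      leibniz_lie := leibniz }
  let φ : FreeLieAlgebra ℤ X →ₗ⁅ℤ⁆ G := lift ℤ f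
  exact ⟨φ.toLinearMap.toAddMonoidHom, fun x => lift_of_apply f x, fun a b => φ.map_lie a b⟩

theorem exists_derivation (g : X → FreeLieAlgebra ℤ X) :
    ∃ D : FreeLieAlgebra ℤ X →+ FreeLieAlgebra ℤ X,
      (∀ x, D (of ℤ x) = g x) ∧ ∀ a b, D ⁅a, b⁆ = ⁅D a, b⁆ + ⁅a, D b⁆ := by
  obtain ⟨φ, h1, h2⟩ := exists_lift
    (G := FreeLieAlgebra ℤ X × FreeLieAlgebra ℤ X)
    (fun u v => (⁅u.1, v.1⁆, ⁅u.2, v.1⁆ + ⁅u.1, v.2⁆))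
    (by intro x y z; ext <;> simp; abel)
    (by intro x y z; ext <;> simp; abel)
    (by intro x; ext <;> simp; rw [← lie_skew, neg_add_cancel])
    (by
      intro x y z
      ext
      · simp
      · simp only [Prod.snd_add, lie_add, add_lie]
        rw [leibniz_lie x.2, leibniz_lie x.1 y.2, leibniz_lie x.1 y.1]
        abel)
    (fun x => (of ℤ x, g x))
  have h3 : ∀ a, (φ a).1 = a := by
    apply induction_int
    · intro x; simp [h1]
    · simp
    · intro a b ha hb; simp [ha, hb]
    · intro a ha; simp [ha]
    · intro a b ha hb; simp [h2, ha, hb]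
  refine ⟨(AddMonoidHom.snd _ _).comp φ, fun x => by simp [h1], fun a b => ?_⟩
  simp [h2, h3]

/-- Second cohomology of a free Lie ring with trivial coefficients vanishes. -/
theorem exists_primitive {A : Type*} [AddCommGroup A]
    (c : FreeLieAlgebra ℤ X →+ FreeLieAlgebra ℤ X →+ A) (c_self : ∀ a, c a a = 0)
    (cocycle : ∀ a b d, c ⁅a, b⁆ d + c ⁅b, d⁆ a + c ⁅d, a⁆ b = 0) :
    ∃ f : FreeLieAlgebra ℤ X →+ A, ∀ a b, f ⁅a, b⁆ = c a b := by
  have skew : ∀ a b, c a b = - c b a := by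
    intro a b
    have := c_self (a + b)
    simp only [map_add, AddMonoidHom.add_apply, c_self, zero_add, add_zero] at this
    exact eq_neg_of_add_eq_zero_right this
  obtain ⟨φ, h1, h2⟩ := exists_lift
    (G := FreeLieAlgebra ℤ X × A)
    (fun u v => (⁅u.1, v.1⁆, c u.1 v.1))
    (by intro x y z; ext <;> simp)
    (by intro x y z; ext <;> simp)
    (by intro x; ext <;> simp [c_self])
    (by
      intro x y z
      ext
      · simp
      · simp only [Prod.snd_add]
        have := cocycle x.1 y.1 z.1
        rw [skew x.1, skew y.1, ← lie_skew x.1 z.1]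
        simp only [map_neg, AddMonoidHom.neg_apply, neg_neg]
        rw [← sub_eq_zero, ← neg_eq_zero, ← this]
        abel)
    (fun x => (of ℤ x, 0))
  have h3 : ∀ a, (φ a).1 = a := by
    apply induction_int
    · intro x; simp [h1]
    · simp
    · intro a b ha hb; simp [ha, hb]
    · intro a ha; simp [ha]
    · intro a b ha hb; simp [h2, ha, hb]
  refine ⟨(AddMonoidHom.snd _ _).comp φ, fun a b => ?_⟩
  simp [h2, h3]

/-- The Lie monomials of a given weight, for a weight function on the letters. -/
inductive IsMonomial (w : X → ℕ) : ℕ → FreeLieAlgebra ℤ X → Prop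
  | of (x : X) : IsMonomial w (w x) (of ℤ x)
  | lie {p q : ℕ} {a b : FreeLieAlgebra ℤ X} :
      IsMonomial w p a → IsMonomial w q b → IsMonomial w (p + q) ⁅a, b⁆

theorem IsMonomial.induction (w : X → ℕ) {P : FreeLieAlgebra ℤ X → Prop}
    (mono : ∀ p a, IsMonomial w p a → P a)
    (zero : P 0) (add : ∀ a b, P a → P b → P (a + b)) (neg : ∀ a, P a → P (-a))
    (a : FreeLieAlgebra ℤ X) : P a := by
  have key : a ∈ AddSubgroup.closure {a | ∃ p, IsMonomial w p a} := by
    induction a using induction_int with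
    | of x => exact AddSubgroup.subset_closure ⟨_, .of x⟩
    | zero => exact zero_mem _
    | add a b ha hb => exact add_mem ha hb
    | neg a ha => exact neg_mem ha
    | lie a b ha hb =>
      induction ha, hb using AddSubgroup.closure_induction₂ with
      | mem x y hx hy =>
        obtain ⟨p, hp⟩ := hx
        obtain ⟨q, hq⟩ := hy
        exact AddSubgroup.subset_closure ⟨_, hp.lie hq⟩
      | zero_left => simp
      | zero_right => simp
      | add_left x y z _ _ _ h1 h2 => simpa using add_mem h1 h2
      | add_right x y z _ _ _ h1 h2 => simpa using add_mem h1 h2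
      | neg_left x y _ _ h => rw [neg_lie]; exact neg_mem h
      | neg_right x y _ _ h => rw [lie_neg]; exact neg_mem h
  induction key using AddSubgroup.closure_induction with
  | mem x hx => obtain ⟨p, hp⟩ := hx; exact mono p x hp
  | zero => exact zero
  | add x y _ _ hx hy => exact add x y hx hy
  | neg x _ hx => exact neg x hx

theorem IsMonomial.le {w : X → ℕ} {d : ℕ} (hw : ∀ x, d ≤ w x) {p : ℕ} {a : FreeLieAlgebra ℤ X}
    (h : IsMonomial w p a) : d ≤ p := by
  induction h with
  | of x => exact hw x
  | lie _ _ h1 h2 => omega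

theorem skew_of_apply_self {A B : Type*} [AddCommGroup A] [AddCommGroup B] {c : B →+ B →+ A}
    (c_self : ∀ a, c a a = 0) (a b : B) : c a b = -c b a := by
  have := c_self (a + b)
  simp only [map_add, AddMonoidHom.add_apply, c_self, zero_add, add_zero] at this
  exact eq_neg_of_add_eq_zero_right this

/-- If the Cartan cocycle of an invariant symmetric form becomes a coboundary on the ideal
complementary to a letter `x`, then it is a coboundary. -/
theorem exists_cobounding_of_elimination {A : Type*} [AddCommGroup A] (x : X)
    (β : FreeLieAlgebra ℤ X →+ FreeLieAlgebra ℤ X →+ A)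
    (β_symm : ∀ a b, β a b = β b a) (β_inv : ∀ a b c, β ⁅a, b⁆ c = β a ⁅b, c⁆)
    (ψ : FreeLieAlgebra ℤ (ℕ × {y // y ≠ x}) →+ FreeLieAlgebra ℤ X)
    (ψ_zero : ∀ y, ψ (of ℤ (0, y)) = of ℤ y.1)
    (ψ_succ : ∀ j y, ψ (of ℤ (j + 1, y)) = ⁅of ℤ x, ψ (of ℤ (j, y))⁆)
    (ψ_lie : ∀ a b, ψ ⁅a, b⁆ = ⁅ψ a, ψ b⁆)
    (θ : FreeLieAlgebra ℤ (ℕ × {y // y ≠ x}) →+ FreeLieAlgebra ℤ (ℕ × {y // y ≠ x}) →+ A)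
    (θ_self : ∀ a, θ a a = 0)
    (hθ : ∀ a b c, θ ⁅a, b⁆ c + θ ⁅b, c⁆ a + θ ⁅c, a⁆ b = β (ψ ⁅a, b⁆) (ψ c)) :
    ∃ θ' : FreeLieAlgebra ℤ X →+ FreeLieAlgebra ℤ X →+ A, (∀ a, θ' a a = 0) ∧
      ∀ a b c, θ' ⁅a, b⁆ c + θ' ⁅b, c⁆ a + θ' ⁅c, a⁆ b = β ⁅a, b⁆ c := by
  classical
  have θ_skew := skew_of_apply_self θ_self
  obtain ⟨D, D_of, D_lie⟩ := exists_derivation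
    (fun p : ℕ × {y // y ≠ x} => of ℤ (p.1 + 1, p.2))
  have ψ_D : ∀ a, ψ (D a) = ⁅of ℤ x, ψ a⁆ := by
    apply induction_int
    · rintro ⟨j, y⟩
      rw [D_of, ψ_succ]
    · simp
    · intro a b ha hb; simp [ha, hb]
    · intro a ha; simp [ha]
    · intro a b ha hb
      rw [D_lie, map_add, ψ_lie, ψ_lie, ψ_lie, ha, hb, leibniz_lie (of ℤ x)]
  have β_D : ∀ a b, β (ψ (D a)) (ψ b) = - β (ψ a) (ψ (D b)) := by
    intro a b
    rw [ψ_D, ψ_D, ← lie_skew, map_neg, AddMonoidHom.neg_apply, β_inv]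
  obtain ⟨f, hf⟩ := exists_primitive
    ((θ.comp D) + (AddMonoidHom.compHom.flip D).comp θ)
    (by
      intro a
      simp only [AddMonoidHom.add_apply, AddMonoidHom.comp_apply, AddMonoidHom.flip_apply,
        AddMonoidHom.compHom_apply_apply]
      rw [θ_skew, neg_add_cancel])
    (by
      intro a b c
      simp only [AddMonoidHom.add_apply, AddMonoidHom.comp_apply, AddMonoidHom.flip_apply,
        AddMonoidHom.compHom_apply_apply, D_lie, map_add]
      have h1 := hθ (D a) b c
      have h2 := hθ a (D b) c
      have h3 := hθ a b (D c)
      have h4 := β_D ⁅a, b⁆ c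
      rw [D_lie, map_add, map_add, AddMonoidHom.add_apply, ← h1, ← h2, ← sub_eq_zero,
        sub_neg_eq_add, ← h3] at h4
      rw [← h4]
      abel)
  simp only [AddMonoidHom.add_apply, AddMonoidHom.comp_apply, AddMonoidHom.flip_apply,
        AddMonoidHom.compHom_apply_apply] at hf
  obtain ⟨φ, φ_of, φ_lie⟩ := exists_lift (X := X)
    (G := ℤ × FreeLieAlgebra ℤ (ℕ × {y // y ≠ x}))
    (fun u v => (0, u.1 • D v.2 - v.1 • D u.2 + ⁅u.2, v.2⁆))
    (by intro x y z; ext <;> simp [add_smul]; abel)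
    (by intro x y z; ext <;> simp [add_smul]; abel)
    (by intro x; ext <;> simp)
    (by
      intro x y z
      ext
      · simp
      · simp only [Prod.snd_add, lie_add, add_lie, lie_sub, sub_lie, smul_lie, lie_smul, map_add,
          map_sub, map_zsmul, D_lie, zero_smul, smul_add, smul_sub]
        rw [leibniz_lie x.2 y.2, smul_comm x.1 z.1, smul_comm y.1 z.1, smul_comm x.1 y.1,
          ← lie_skew (D x.2) z.2, ← lie_skew y.2 (D z.2)]
        rw [← lie_skew y.2 (D x.2)]
        simp only [smul_neg]
        abel)
    (fun y => if h : y = x then (1, 0) else (0, of ℤ (0, ⟨y, h⟩)))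
  have hφ : ∀ a, (φ a).1 • of ℤ x + ψ (φ a).2 = a := by
    apply induction_int
    · intro y
      rw [φ_of]
      by_cases h : y = x
      · simp [h]
      · simp [h, ψ_zero]
    · simp
    · intro a b ha hb
      conv_rhs => rw [← ha, ← hb]
      simp only [map_add, Prod.fst_add, Prod.snd_add, add_smul]
      abel
    · intro a ha
      conv_rhs => rw [← ha]
      simp only [map_neg, Prod.fst_neg, Prod.snd_neg, neg_smul]
      abel
    · intro a b ha hb
      conv_rhs => rw [← ha, ← hb]
      simp only [φ_lie, zero_smul, map_add, map_sub, map_zsmul, ψ_D, ψ_lie, lie_add, add_lie,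
        smul_lie, lie_smul, lie_self, smul_zero]
      rw [← lie_skew (ψ (φ a).2) (of ℤ x)]
      simp only [zero_add, smul_neg]
      abel
  let pr : FreeLieAlgebra ℤ X →+ FreeLieAlgebra ℤ (ℕ × {y // y ≠ x}) :=
    (AddMonoidHom.snd _ _).comp φ
  let n : FreeLieAlgebra ℤ X →+ ℤ := (AddMonoidHom.fst _ _).comp φ
  let g : FreeLieAlgebra ℤ (ℕ × {y // y ≠ x}) →+ A := f - (β (of ℤ x)).comp ψ
  have hn : ∀ a b : FreeLieAlgebra ℤ X, n ⁅a, b⁆ = 0 := fun a b => by simp [n, φ_lie]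
  have hpr : ∀ a b : FreeLieAlgebra ℤ X,
      pr ⁅a, b⁆ = n a • D (pr b) - n b • D (pr a) + ⁅pr a, pr b⁆ :=
    fun a b => by simp [n, pr, φ_lie]
  have hdec : ∀ a, n a • of ℤ x + ψ (pr a) = a := hφ
  have key : ∀ a b, θ (D a) b - θ (D b) a - g ⁅a, b⁆ = β (ψ (D a)) (ψ b) := by
    intro a b
    simp only [g, AddMonoidHom.sub_apply, hf, AddMonoidHom.comp_apply, ψ_lie, ψ_D, β_inv]
    rw [θ_skew a]
    abel
  let θ' : FreeLieAlgebra ℤ X →+ FreeLieAlgebra ℤ X →+ A :=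
    AddMonoidHom.mk' (fun a => (θ (pr a)).comp pr + n a • g.comp pr -
      AddMonoidHom.mk' (fun b => n b • g (pr a)) (by intro b c; simp [add_smul])) (by
        intro a b
        ext c
        simp [add_smul]
        abel)
  have θ'_apply : ∀ a b, θ' a b = θ (pr a) (pr b) + n a • g (pr b) - n b • g (pr a) :=
    fun _ _ => rfl
  refine ⟨θ', fun a => by simp [θ'_apply, θ_self], fun a b c => ?_⟩
  have β_x : ∀ a b : FreeLieAlgebra ℤ X, β ⁅a, b⁆ (of ℤ x) = β (ψ (D (pr a))) (ψ (pr b)) := by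
    intro a b
    conv_lhs => rw [← hdec ⁅a, b⁆, hn, zero_smul, zero_add, hpr]
    simp only [map_add, map_sub, map_zsmul, ψ_D, ψ_lie, AddMonoidHom.add_apply,
      AddMonoidHom.sub_apply, AddMonoidHom.smul_apply]
    have h (a) : β ⁅of ℤ x, ψ a⁆ (of ℤ x) = 0 := by
      rw [β_symm, ← β_inv, lie_self, map_zero, AddMonoidHom.zero_apply]
    rw [h, h, β_symm, ← β_inv]
    simp
  have expand : β ⁅a, b⁆ c = n c • β (ψ (D (pr a))) (ψ (pr b)) +
      β (ψ (pr ⁅a, b⁆)) (ψ (pr c)) := by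
    conv_lhs => rw [← hdec c, map_add, map_zsmul, β_x]
    conv_lhs => rw [← hdec ⁅a, b⁆, hn, zero_smul, zero_add]
  rw [expand]
  simp only [θ'_apply, hn, hpr, zero_smul, add_zero, map_add, map_sub, map_zsmul,
    AddMonoidHom.add_apply, AddMonoidHom.sub_apply, AddMonoidHom.smul_apply, smul_add, smul_sub]
  linear_combination (norm := module) n c • key (pr a) (pr b) + n a • key (pr b) (pr c) +
    n b • key (pr c) (pr a) + hθ (pr a) (pr b) (pr c) + n b • β_D (pr a) (pr c) -
    n b • β_symm (ψ (pr a)) (ψ (D (pr c)))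

theorem IsMonomial.map {X Y : Type*} {w : X → ℕ} {v : Y → ℕ}
    {ψ : FreeLieAlgebra ℤ X →+ FreeLieAlgebra ℤ Y} (ψ_lie : ∀ a b, ψ ⁅a, b⁆ = ⁅ψ a, ψ b⁆)
    (ψ_of : ∀ x, IsMonomial v (w x) (ψ (FreeLieAlgebra.of ℤ x))) {p : ℕ}
    {a : FreeLieAlgebra ℤ X} (h : IsMonomial w p a) : IsMonomial v p (ψ a) := by
  induction h with
  | of x => exact ψ_of x
  | lie _ _ h1 h2 => rw [ψ_lie]; exact h1.lie h2

theorem exists_cobounding_aux {A : Type*} [AddCommGroup A] (N : ℕ) (r : ℕ) :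
    ∀ d : ℕ, 1 ≤ d → d + r = N + 1 → ∀ (c : ℕ) (Y : Type) (w : Y → ℕ), (∀ y, d ≤ w y) →
      (∀ e, {y | w y = e}.Finite) → {y | w y = d}.ncard = c →
      ∀ β : FreeLieAlgebra ℤ Y →+ FreeLieAlgebra ℤ Y →+ A, (∀ a b, β a b = β b a) →
      (∀ a b c, β ⁅a, b⁆ c = β a ⁅b, c⁆) →
      (∀ p q a b, IsMonomial w p a → IsMonomial w q b → N < p + q → β a b = 0) →
      ∃ θ : FreeLieAlgebra ℤ Y →+ FreeLieAlgebra ℤ Y →+ A, (∀ a, θ a a = 0) ∧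
        ∀ a b c, θ ⁅a, b⁆ c + θ ⁅b, c⁆ a + θ ⁅c, a⁆ b = β ⁅a, b⁆ c := by
  induction r with
  | zero =>
    intro d hd hdr c Y w hw _ _ β _ _ hβ
    have β_zero : ∀ a b, β a b = 0 := by
      intro a b
      induction a using IsMonomial.induction w with
      | mono p a ha =>
        induction b using IsMonomial.induction w with
        | mono q b hb =>
          have := ha.le hw
          have := hb.le hw
          exact hβ p q a b ha hb (by omega)
        | zero => simp
        | add x y hx hy => simp [hx, hy]
        | neg x hx => simp [hx]
      | zero => simp
      | add x y hx hy => simp [hx, hy]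
      | neg x hx => simp [hx]
    exact ⟨0, fun _ => rfl, fun a b c => by simp [β_zero]⟩
  | succ r ihr =>
    intro d hd hdr c
    induction c with
    | zero =>
      intro Y w hw hfin hcard β β_symm β_inv hβ
      rw [Set.ncard_eq_zero (hfin d)] at hcard
      refine ihr (d + 1) (by omega) (by omega) _ Y w (fun y => ?_) hfin rfl β β_symm β_inv hβ
      have h1 := hw y
      have h2 : w y ≠ d := fun h => (Set.eq_empty_iff_forall_notMem.1 hcard y) h
      omega
    | succ c ihc =>
      intro Y w hw hfin hcard β β_symm β_inv hβ
      obtain ⟨x, x_mem⟩ : {y | w y = d}.Nonempty := by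
        rw [← Set.ncard_pos (hfin d)]
        omega
      have hx : w x = d := x_mem
      obtain ⟨ψ, ψ_of, ψ_lie⟩ := exists_lift (X := ℕ × {y // y ≠ x})
        (G := FreeLieAlgebra ℤ Y) (fun a b => ⁅a, b⁆) add_lie lie_add lie_self leibniz_lie
        (fun p => (fun a => ⁅of ℤ x, a⁆)^[p.1] (of ℤ p.2.1))
      let w' : ℕ × {y // y ≠ x} → ℕ := fun p => w p.2.1 + p.1 * d
      have ψ_zero : ∀ y, ψ (of ℤ (0, y)) = of ℤ y.1 := fun y => by rw [ψ_of]; rfl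
      have ψ_succ : ∀ j y, ψ (of ℤ (j + 1, y)) = ⁅of ℤ x, ψ (of ℤ (j, y))⁆ := by
        intro j y
        rw [ψ_of, ψ_of, Function.iterate_succ_apply']
      have ψ_mono : ∀ p, IsMonomial w (w' p) (ψ (of ℤ p)) := by
        rintro ⟨j, y⟩
        induction j with
        | zero => simpa [w', ψ_zero] using IsMonomial.of (w := w) y.1
        | succ j ih =>
          rw [ψ_succ]
          have := (IsMonomial.of (w := w) x).lie ih
          convert this using 1
          simp only [w', hx]
          ring
      have hw' : ∀ p, d ≤ w' p := fun p => (hw _).trans (Nat.le_add_right _ _)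
      have hfin' : ∀ e, {p | w' p = e}.Finite := by
        intro e
        have hS : (⋃ i ∈ Set.Iic e, {y | w y = i}).Finite :=
          (Set.finite_Iic e).biUnion fun i _ => hfin i
        have hT : {y : {y // y ≠ x} | w y.1 ≤ e}.Finite := by
          refine Set.Finite.subset (hS.preimage Subtype.val_injective.injOn) ?_
          intro y hy
          simpa using hy
        refine Set.Finite.subset ((Set.finite_Iic e).prod hT) ?_
        rintro ⟨j, y⟩ h
        have h : w y.1 + j * d = e := h
        have h2 : j ≤ j * d := Nat.le_mul_of_pos_right _ (by omega)
        exact ⟨by simp; omega, by simp; omega⟩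
      have hcard' : {p | w' p = d}.ncard = c := by
        have h1 : {p | w' p = d} = (fun y => (0, y)) '' {y : {y // y ≠ x} | w y.1 = d} := by
          ext ⟨j, y⟩
          have := hw y.1
          constructor
          · intro h
            have h : w y.1 + j * d = d := h
            have h0 : j = 0 := by
              by_contra h0
              have : d ≤ j * d := Nat.le_mul_of_pos_left _ (by omega)
              omega
            subst h0
            exact ⟨y, by simpa using h, rfl⟩
          · rintro ⟨z, hz, h⟩
            cases h
            simpa [w'] using hz
        have h2 : Subtype.val '' {y : {y // y ≠ x} | w y.1 = d} = {y | w y = d} \ {x} := by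
          ext y
          simp [and_comm]
        rw [h1, Set.ncard_image_of_injective _ (fun a b h => (Prod.ext_iff.1 h).2),
          ← Set.ncard_image_of_injective _ Subtype.val_injective, h2,
          Set.ncard_sdiff_singleton_of_mem x_mem, hcard,
          Nat.add_sub_cancel]
      obtain ⟨θ, θ_self, hθ⟩ := ihc _ w' hw' hfin' hcard'
        ((AddMonoidHom.compHom.flip ψ).comp (β.comp ψ))
        (fun a b => β_symm _ _) (fun a b c => by simp [ψ_lie, β_inv])
        (fun p q a b ha hb h =>
          hβ p q _ _ (ha.map ψ_lie ψ_mono) (hb.map ψ_lie ψ_mono) h)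
      exact exists_cobounding_of_elimination x β β_symm β_inv ψ ψ_zero ψ_succ ψ_lie θ θ_self hθ

/-- The Cartan cocycle of an invariant symmetric form of bounded degree on a finitely generated
free Lie ring is a coboundary. -/
theorem exists_cobounding {A : Type*} [AddCommGroup A] {X : Type} [Finite X] (N : ℕ)
    (β : FreeLieAlgebra ℤ X →+ FreeLieAlgebra ℤ X →+ A) (β_symm : ∀ a b, β a b = β b a)
    (β_inv : ∀ a b c, β ⁅a, b⁆ c = β a ⁅b, c⁆)
    (hβ : ∀ p q a b, IsMonomial (fun _ => 1) p a → IsMonomial (fun _ => 1) q b →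
      N < p + q → β a b = 0) :
    ∃ θ : FreeLieAlgebra ℤ X →+ FreeLieAlgebra ℤ X →+ A, (∀ a, θ a a = 0) ∧
      ∀ a b c, θ ⁅a, b⁆ c + θ ⁅b, c⁆ a + θ ⁅c, a⁆ b = β ⁅a, b⁆ c :=
  exists_cobounding_aux N N 1 le_rfl (add_comm _ _) _ X (fun _ => 1) (fun _ => le_rfl)
    (fun _ => Set.toFinite _) rfl β β_symm β_inv hβ

end FreeLieAlgebra

section LieFunctionals

variable {m : ℕ} {A : Type*} [AddCommGroup A]

/-- A function on rooted trees that respects the relations of a Lie bracket at every position. -/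
structure IsLieFunctional (g : RTree m → A) : Prop where
  skew : ∀ (c : Ctx m) (a b : RTree m), g (c.fill (.node a b)) + g (c.fill (.node b a)) = 0
  jacobi : ∀ (c : Ctx m) (a b d : RTree m), g (c.fill (.node a (.node b d))) -
    g (c.fill (.node (.node a b) d)) - g (c.fill (.node b (.node a d))) = 0
  square : ∀ (c : Ctx m) (a : RTree m), g (c.fill (.node a a)) = 0

variable (m) in
/-- The relators of the free Lie ring, in all degrees at once. -/
def freeLieRels : Set (FreeAbelianGroup (RTree m)) :=
  {x | ∃ (c : Ctx m) (a b : RTree m),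
      x = FreeAbelianGroup.of (c.fill (.node a b)) + FreeAbelianGroup.of (c.fill (.node b a))} ∪
  {x | ∃ (c : Ctx m) (a b d : RTree m),
      x = FreeAbelianGroup.of (c.fill (.node a (.node b d))) -
          FreeAbelianGroup.of (c.fill (.node (.node a b) d)) -
          FreeAbelianGroup.of (c.fill (.node b (.node a d)))} ∪
  {x | ∃ (c : Ctx m) (a : RTree m), x = FreeAbelianGroup.of (c.fill (.node a a))}

variable (m) in
/-- The free Lie ring, presented by rooted trees. -/
abbrev TreeLieRing := FreeAbelianGroup (RTree m) ⧸ AddSubgroup.closure (freeLieRels m)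

namespace TreeLieRing

/-- The class of a rooted tree. -/
def mk (t : RTree m) : TreeLieRing m := QuotientAddGroup.mk (FreeAbelianGroup.of t)

theorem isLieFunctional_mk : IsLieFunctional (mk : RTree m → TreeLieRing m) where
  skew c a b := (QuotientAddGroup.eq_zero_iff _).2
    (AddSubgroup.subset_closure (Or.inl (Or.inl ⟨c, a, b, rfl⟩)))
  jacobi c a b d := (QuotientAddGroup.eq_zero_iff _).2
    (AddSubgroup.subset_closure (Or.inl (Or.inr ⟨c, a, b, d, rfl⟩)))
  square c a := (QuotientAddGroup.eq_zero_iff _).2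
    (AddSubgroup.subset_closure (Or.inr ⟨c, a, rfl⟩))

theorem induction {P : TreeLieRing m → Prop} (mk : ∀ t, P (mk t)) (zero : P 0)
    (add : ∀ x y, P x → P y → P (x + y)) (neg : ∀ x, P x → P (-x)) (x : TreeLieRing m) :
    P x := by
  obtain ⟨x, rfl⟩ := QuotientAddGroup.mk_surjective x
  induction x using FreeAbelianGroup.induction_on with
  | zero => exact zero
  | of t => exact mk t
  | neg t h => exact neg _ h
  | add x y hx hy => exact add _ _ hx hy

/-- The homomorphism out of the free Lie ring given by a Lie functional. -/
def lift {g : RTree m → A} (hg : IsLieFunctional g) : TreeLieRing m →+ A :=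
  QuotientAddGroup.lift _ (FreeAbelianGroup.lift g) (by
    rw [AddSubgroup.closure_le]
    rintro x ((⟨c, a, b, rfl⟩ | ⟨c, a, b, d, rfl⟩) | ⟨c, a, rfl⟩)
    · simpa using hg.skew c a b
    · simpa using hg.jacobi c a b d
    · simpa using hg.square c a)

@[simp]
theorem lift_mk {g : RTree m → A} (hg : IsLieFunctional g) (t : RTree m) :
    lift hg (mk t) = g t :=
  FreeAbelianGroup.lift_apply_of g t

theorem hom_ext {f g : TreeLieRing m →+ A} (h : ∀ t, f (mk t) = g (mk t)) : f = g := by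
  ext t
  exact h t

theorem exists_bracket : ∃ br : TreeLieRing m →+ TreeLieRing m →+ TreeLieRing m,
    (∀ s t, br (mk s) (mk t) = mk (.node s t)) := by
  have h (s : RTree m) : IsLieFunctional fun t => (mk (.node s t) : TreeLieRing m) :=
    ⟨fun c => isLieFunctional_mk.skew (c.nodeR s), fun c => isLieFunctional_mk.jacobi (c.nodeR s),
      fun c => isLieFunctional_mk.square (c.nodeR s)⟩
  have hh : IsLieFunctional fun s => lift (h s) := by
    refine ⟨fun c a b => ?_, fun c a b d => ?_, fun c a => ?_⟩ <;>
      refine hom_ext fun t => ?_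
    · simpa [Ctx.fill] using isLieFunctional_mk.skew (c.nodeL t) a b
    · simpa [Ctx.fill] using isLieFunctional_mk.jacobi (c.nodeL t) a b d
    · simpa [Ctx.fill] using isLieFunctional_mk.square (c.nodeL t) a
  exact ⟨lift hh, fun s t => by simp⟩

end TreeLieRing

namespace RTree

/-- The value of a bracket monomial in the free Lie ring. -/
noncomputable def eval : RTree m → FreeLieAlgebra ℤ (Fin m)
  | leaf i => FreeLieAlgebra.of ℤ i
  | node a b => ⁅eval a, eval b⁆

theorem exists_eval_of_isMonomial {p : ℕ} {a : FreeLieAlgebra ℤ (Fin m)}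
    (h : FreeLieAlgebra.IsMonomial (fun _ => 1) p a) : ∃ t : RTree m, t.eval = a ∧ t.deg = p := by
  induction h with
  | of i => exact ⟨leaf i, rfl, rfl⟩
  | lie _ _ h1 h2 =>
    obtain ⟨s, rfl, rfl⟩ := h1
    obtain ⟨t, rfl, rfl⟩ := h2
    exact ⟨node s t, rfl, rfl⟩

theorem eval_induction {P : FreeLieAlgebra ℤ (Fin m) → Prop} (eval : ∀ t : RTree m, P t.eval)
    (zero : P 0) (add : ∀ x y, P x → P y → P (x + y)) (neg : ∀ x, P x → P (-x))
    (x : FreeLieAlgebra ℤ (Fin m)) : P x := by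
  refine FreeLieAlgebra.IsMonomial.induction (fun _ => 1) (fun p a h => ?_) zero add neg x
  obtain ⟨t, rfl, -⟩ := exists_eval_of_isMonomial h
  exact eval t

theorem hom_ext {f g : FreeLieAlgebra ℤ (Fin m) →+ A} (h : ∀ t : RTree m, f t.eval = g t.eval) :
    f = g := by
  ext x
  induction x using eval_induction with
  | eval t => exact h t
  | zero => simp
  | add x y hx hy => simp [hx, hy]
  | neg x hx => simp [hx]

theorem isLieFunctional_eval : IsLieFunctional (eval : RTree m → FreeLieAlgebra ℤ (Fin m)) := by
  refine ⟨fun c a b => ?_, fun c a b d => ?_, fun c a => ?_⟩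
  · induction c with
    | hole =>
      simp only [Ctx.fill, eval]
      rw [← lie_skew, neg_add_cancel]
    | nodeL c r ih => simp only [Ctx.fill, eval]; rw [← add_lie, ih, zero_lie]
    | nodeR l c ih => simp only [Ctx.fill, eval]; rw [← lie_add, ih, lie_zero]
  · induction c with
    | hole =>
      simp only [Ctx.fill, eval]
      rw [leibniz_lie]
      abel
    | nodeL c r ih => simp only [Ctx.fill, eval]; rw [← sub_lie, ← sub_lie, ih, zero_lie]
    | nodeR l c ih => simp only [Ctx.fill, eval]; rw [← lie_sub, ← lie_sub, ih, lie_zero]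
  · induction c with
    | hole => simp [Ctx.fill, eval]
    | nodeL c r ih => simp only [Ctx.fill, eval]; rw [ih, zero_lie]
    | nodeR l c ih => simp only [Ctx.fill, eval]; rw [ih, lie_zero]

end RTree

theorem exists_hom_freeLieAlgebra_treeLieRing :
    ∃ φ : FreeLieAlgebra ℤ (Fin m) →+ TreeLieRing m,
      ∀ t : RTree m, φ t.eval = TreeLieRing.mk t := by
  obtain ⟨br, hbr⟩ := TreeLieRing.exists_bracket (m := m)
  have skew : ∀ x y, br x y + br y x = 0 := by
    intro x y
    induction x using TreeLieRing.induction with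
    | zero => simp
    | neg x hx => rw [map_neg, map_neg, AddMonoidHom.neg_apply, ← neg_add, hx, neg_zero]
    | add x x' hx hx' =>
      simp only [map_add, AddMonoidHom.add_apply]
      rw [add_add_add_comm, hx, hx', add_zero]
    | mk s =>
      induction y using TreeLieRing.induction with
      | zero => simp
      | neg x hx => rw [map_neg, map_neg, AddMonoidHom.neg_apply, ← neg_add, hx, neg_zero]
      | add x x' hx hx' =>
        simp only [map_add, AddMonoidHom.add_apply]
        rw [add_add_add_comm, hx, hx', add_zero]
      | mk t =>
        simp only [hbr]
        exact TreeLieRing.isLieFunctional_mk.skew .hole s t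
  obtain ⟨φ, φ_of, φ_lie⟩ := FreeLieAlgebra.exists_lift (X := Fin m) (G := TreeLieRing m)
    (fun x y => br x y) (fun x y z => by simp) (fun x y z => by simp)
    (by
      intro x
      induction x using TreeLieRing.induction with
      | zero => simp
      | neg x hx => simpa using hx
      | add x y hx hy =>
        simp only [map_add, AddMonoidHom.add_apply, hx, hy, zero_add, add_zero]
        exact skew _ _
      | mk s =>
        rw [hbr]
        exact TreeLieRing.isLieFunctional_mk.square .hole s)
    (by
      intro x y z
      induction x using TreeLieRing.induction with
      | zero => simp
      | neg x hx => simp only [map_neg, AddMonoidHom.neg_apply, hx, neg_add]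
      | add x x' hx hx' => simp only [map_add, AddMonoidHom.add_apply, hx, hx']; abel
      | mk r =>
      induction y using TreeLieRing.induction with
      | zero => simp
      | neg x hx => simp only [map_neg, AddMonoidHom.neg_apply, hx, neg_add]
      | add x x' hx hx' => simp only [map_add, AddMonoidHom.add_apply, hx, hx']; abel
      | mk s =>
      induction z using TreeLieRing.induction with
      | zero => simp
      | neg x hx => simp only [map_neg, hx, neg_add]
      | add x x' hx hx' => simp only [map_add, hx, hx']; abel
      | mk t =>
        simp only [hbr]
        have := TreeLieRing.isLieFunctional_mk.jacobi .hole r s t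
        rwa [sub_sub, sub_eq_zero] at this)
    (fun i => TreeLieRing.mk (.leaf i))
  refine ⟨φ, fun t => ?_⟩
  induction t with
  | leaf i => exact φ_of i
  | node a b ha hb => rw [RTree.eval, φ_lie, ha, hb, hbr]

namespace IsLieFunctional

theorem exists_hom {g : RTree m → A} (hg : IsLieFunctional g) :
    ∃ φ : FreeLieAlgebra ℤ (Fin m) →+ A, ∀ t : RTree m, φ t.eval = g t := by
  obtain ⟨φ, hφ⟩ := exists_hom_freeLieAlgebra_treeLieRing (m := m)
  exact ⟨(TreeLieRing.lift hg).comp φ, fun t => by simp [hφ]⟩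

theorem exists_hom₂ {g : RTree m → RTree m → A} (left : ∀ t, IsLieFunctional fun s => g s t)
    (right : ∀ s, IsLieFunctional (g s)) :
    ∃ φ : FreeLieAlgebra ℤ (Fin m) →+ FreeLieAlgebra ℤ (Fin m) →+ A,
      ∀ s t : RTree m, φ s.eval t.eval = g s t := by
  choose ψ hψ using fun s => (right s).exists_hom
  have h : IsLieFunctional ψ := by
    refine ⟨fun c a b => ?_, fun c a b d => ?_, fun c a => ?_⟩ <;>
      refine RTree.hom_ext fun t => ?_
    · simpa [hψ] using (left t).skew c a b
    · simpa [hψ] using (left t).jacobi c a b d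
    · simpa [hψ] using (left t).square c a
  obtain ⟨φ, hφ⟩ := h.exists_hom
  exact ⟨φ, fun s t => by rw [hφ, hψ]⟩

end IsLieFunctional

end LieFunctionals

namespace FreeLieAlgebra

variable {X M : Type*} [AddCommGroup M]

/-- The extension of maps given on letters to all Lie elements, by moving brackets into the second
argument. -/
theorem exists_reroot (u : X → FreeLieAlgebra ℤ X →+ M) :
    ∃ ρ : FreeLieAlgebra ℤ X →+ FreeLieAlgebra ℤ X →+ M, (∀ x, ρ (of ℤ x) = u x) ∧
      ∀ a b t, ρ ⁅a, b⁆ t = ρ a ⁅b, t⁆ - ρ b ⁅a, t⁆ := by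
  let ad (a : FreeLieAlgebra ℤ X) : FreeLieAlgebra ℤ X →+ FreeLieAlgebra ℤ X :=
    AddMonoidHom.mk' (fun t => ⁅a, t⁆) (lie_add a)
  have ad_apply : ∀ a t, ad a t = ⁅a, t⁆ := fun _ _ => rfl
  obtain ⟨φ, h1, h2⟩ := exists_lift
    (G := FreeLieAlgebra ℤ X × (FreeLieAlgebra ℤ X →+ M))
    (fun p q => (⁅p.1, q.1⁆, p.2.comp (ad q.1) - q.2.comp (ad p.1)))
    (by intro x y z; ext <;> simp [ad_apply]; abel)
    (by intro x y z; ext <;> simp [ad_apply]; abel)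
    (by intro x; ext <;> simp)
    (by
      intro x y z
      ext t
      · simp
      · simp only [Prod.snd_add, AddMonoidHom.sub_apply, AddMonoidHom.add_apply,
          AddMonoidHom.comp_apply, ad_apply, lie_lie, map_sub]
        abel)
    (fun x => (of ℤ x, u x))
  have h3 : ∀ a, (φ a).1 = a := by
    apply induction_int
    · intro x; simp [h1]
    · simp
    · intro a b ha hb; simp [ha, hb]
    · intro a ha; simp [ha]
    · intro a b ha hb; simp [h2, ha, hb]
  refine ⟨(AddMonoidHom.snd _ _).comp φ, fun x => by simp [h1], fun a b t => ?_⟩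
  simp [h2, h3, ad_apply]

theorem exists_primitive_of_derivation
    {ρ : FreeLieAlgebra ℤ X →+ FreeLieAlgebra ℤ X →+ M}
    (ρ_lie : ∀ a b t, ρ ⁅a, b⁆ t = ρ a ⁅b, t⁆ - ρ b ⁅a, t⁆)
    {E : FreeLieAlgebra ℤ X →+ FreeLieAlgebra ℤ X} (E_lie : ∀ a b, E ⁅a, b⁆ = ⁅E a, b⁆ + ⁅a, E b⁆) :
    ∃ f : FreeLieAlgebra ℤ X →+ M, ∀ a b, f ⁅a, b⁆ = ρ b (E a) - ρ a (E b) := by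
  refine exists_primitive (ρ.flip.comp E - (AddMonoidHom.compHom.flip E).comp ρ)
    (fun a => sub_self _) (fun a b c => ?_)
  simp only [AddMonoidHom.sub_apply, AddMonoidHom.comp_apply, AddMonoidHom.flip_apply,
    AddMonoidHom.compHom_apply_apply, AddMonoidHom.add_apply, ρ_lie, E_lie, map_add]
  rw [← lie_skew c (E b), ← lie_skew a (E c), ← lie_skew b (E a)]
  simp only [map_neg]
  abel

theorem exists_primitive_of_cobounding
    {ρ : FreeLieAlgebra ℤ X →+ FreeLieAlgebra ℤ X →+ M}
    (ρ_lie : ∀ a b t, ρ ⁅a, b⁆ t = ρ a ⁅b, t⁆ - ρ b ⁅a, t⁆)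
    {θ : FreeLieAlgebra ℤ X →+ FreeLieAlgebra ℤ X →+ M} (θ_self : ∀ a, θ a a = 0)
    (hθ : ∀ a b c, θ ⁅a, b⁆ c + θ ⁅b, c⁆ a + θ ⁅c, a⁆ b = ρ ⁅a, b⁆ c + ρ c ⁅a, b⁆) :
    ∃ f : FreeLieAlgebra ℤ X →+ M, ∀ a b, f ⁅a, b⁆ = θ a b - (ρ a b - ρ b a) := by
  refine exists_primitive (θ - (ρ - ρ.flip)) (fun a => ?_) (fun a b c => ?_)
  · simp [θ_self]
  · have := hθ a b c
    simp only [AddMonoidHom.sub_apply, AddMonoidHom.flip_apply, ρ_lie] at this ⊢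
    rw [← sub_eq_zero] at this
    rw [← this, ← lie_skew a c, ← lie_skew b a, ← lie_skew c b]
    simp only [map_neg]
    abel

end FreeLieAlgebra

section TreePairing

variable {m : ℕ}

theorem Ctx.deg_fill_congr (c : Ctx m) {s t : RTree m} (h : s.deg = t.deg) :
    (c.fill s).deg = (c.fill t).deg := by
  induction c with
  | hole => exact h
  | nodeL c r ih => simp [Ctx.fill, RTree.deg, ih]
  | nodeR l c ih => simp [Ctx.fill, RTree.deg, ih]

theorem RTree.exists_derivation_eval :
    ∃ E : FreeLieAlgebra ℤ (Fin m) →+ FreeLieAlgebra ℤ (Fin m),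
    (∀ i, E (.of ℤ i) = .of ℤ i) ∧ (∀ a b, E ⁅a, b⁆ = ⁅E a, b⁆ + ⁅a, E b⁆) ∧
      ∀ t : RTree m, E t.eval = t.deg • t.eval := by
  obtain ⟨E, E_of, E_lie⟩ := FreeLieAlgebra.exists_derivation (FreeLieAlgebra.of ℤ : Fin m → _)
  refine ⟨E, E_of, E_lie, fun t => ?_⟩
  induction t with
  | leaf i => simp [RTree.eval, E_of, RTree.deg]
  | node a b ha hb => simp [RTree.eval, E_lie, ha, hb, RTree.deg, add_smul]

namespace LL

theorem mk_of_deg_ne {n : ℕ} {t : RTree m} (h : t.deg ≠ n) :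
    LLMk m n (FreeAbelianGroup.of t) = 0 :=
  (QuotientAddGroup.eq_zero_iff _).2
    (AddSubgroup.subset_closure (Or.inl (Or.inl (Or.inl ⟨t, h, rfl⟩))))

theorem isLieFunctional_mk (n : ℕ) :
    IsLieFunctional fun t : RTree m => LLMk m n (FreeAbelianGroup.of t) where
  skew c a b := (QuotientAddGroup.eq_zero_iff _).2
    (AddSubgroup.subset_closure (Or.inl (Or.inl (Or.inr ⟨c, a, b, rfl⟩))))
  jacobi c a b d := (QuotientAddGroup.eq_zero_iff _).2
    (AddSubgroup.subset_closure (Or.inl (Or.inr ⟨c, a, b, d, rfl⟩)))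
  square c a := (QuotientAddGroup.eq_zero_iff _).2
    (AddSubgroup.subset_closure (Or.inr ⟨c, a, rfl⟩))

theorem induction {n : ℕ} {P : LL m n → Prop}
    (mk : ∀ t : RTree m, t.deg = n → P (LLMk m n (FreeAbelianGroup.of t))) (zero : P 0)
    (add : ∀ x y, P x → P y → P (x + y)) (neg : ∀ x, P x → P (-x)) (x : LL m n) : P x := by
  have mk' (t : RTree m) : P (LLMk m n (FreeAbelianGroup.of t)) := by
    by_cases h : t.deg = n
    · exact mk t h
    · rw [mk_of_deg_ne h]
      exact zero
  obtain ⟨x, rfl⟩ := QuotientAddGroup.mk_surjective x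
  induction x using FreeAbelianGroup.induction_on with
  | zero => exact zero
  | of t => exact mk' t
  | neg t _ => exact neg _ (mk' t)
  | add x y hx hy => exact add _ _ hx hy

theorem exists_inclusion (n : ℕ) : ∃ ι : LL m n →+ FreeLieAlgebra ℤ (Fin m),
    ∀ t : RTree m, t.deg = n → ι (LLMk m n (FreeAbelianGroup.of t)) = t.eval := by
  refine ⟨QuotientAddGroup.lift _
    (FreeAbelianGroup.lift fun t : RTree m => if t.deg = n then t.eval else 0) ?_, ?_⟩
  · rw [AddSubgroup.closure_le]
    rintro x (((⟨t, ht, rfl⟩ | ⟨c, a, b, rfl⟩) | ⟨c, a, b, d, rfl⟩) | ⟨c, a, rfl⟩)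
    · simp [ht]
    · have h : (c.fill (.node b a)).deg = (c.fill (.node a b)).deg :=
        c.deg_fill_congr (add_comm _ _)
      have := RTree.isLieFunctional_eval.skew c a b
      by_cases hn : (c.fill (.node a b)).deg = n <;> simp [h, hn, this]
    · have h1 : (c.fill (.node (.node a b) d)).deg = (c.fill (.node a (.node b d))).deg :=
        c.deg_fill_congr (by simp only [RTree.deg]; omega)
      have h2 : (c.fill (.node b (.node a d))).deg = (c.fill (.node a (.node b d))).deg :=
        c.deg_fill_congr (by simp only [RTree.deg]; omega)
      have := RTree.isLieFunctional_eval.jacobi c a b d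
      by_cases hn : (c.fill (.node a (.node b d))).deg = n <;> simp [h1, h2, hn, this]
    · have := RTree.isLieFunctional_eval.square c a
      simp [this]
  · intro t ht
    exact (FreeAbelianGroup.lift_apply_of _ t).trans (if_pos ht)

end LL

namespace Tinfodd

variable {k : ℕ}

/-- The class of the unrooted tree obtained by gluing the roots of two rooted trees. -/
def glue (k : ℕ) (s t : RTree m) : Tinfodd m k := TinfoddMk m k (FreeAbelianGroup.of (s, t))

theorem mk_eq_zero {x : FreeAbelianGroup (RTree m × RTree m)}
    (h : x ∈ treeRels m (2 * k - 1) ∪ btRels m k) : TinfoddMk m k x = 0 :=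
  (QuotientAddGroup.eq_zero_iff _).2 (AddSubgroup.subset_closure h)

theorem glue_of_deg_ne {s t : RTree m} (h : s.deg + t.deg ≠ 2 * k - 1 + 2) : glue k s t = 0 :=
  mk_eq_zero (Or.inl (Or.inl (Or.inl (Or.inl (Or.inl ⟨(s, t), h, rfl⟩)))))

theorem glue_comm (s t : RTree m) : glue k s t = glue k t s :=
  sub_eq_zero.1 <| (map_sub (TinfoddMk m k) _ _).symm.trans <|
    mk_eq_zero (Or.inl (Or.inl (Or.inl (Or.inl (Or.inr ⟨s, t, rfl⟩)))))

theorem glue_node (a b c : RTree m) : glue k (.node a b) c = glue k a (.node b c) :=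
  sub_eq_zero.1 <| (map_sub (TinfoddMk m k) _ _).symm.trans <|
    mk_eq_zero (Or.inl (Or.inl (Or.inl (Or.inr ⟨a, b, c, rfl⟩))))

theorem glue_skew (a b c : RTree m) : glue k (.node a b) c + glue k (.node b a) c = 0 :=
  (map_add (TinfoddMk m k) _ _).symm.trans <|
    mk_eq_zero (Or.inl (Or.inl (Or.inr ⟨a, b, c, rfl⟩)))

theorem glue_jacobi (a b c d : RTree m) : glue k (.node a (.node b c)) d -
    glue k (.node (.node a b) c) d - glue k (.node b (.node a c)) d = 0 := by
  have := mk_eq_zero (k := k) (Or.inl (Or.inr ⟨a, b, c, d, rfl⟩))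
  rwa [map_sub, map_sub] at this

theorem glue_twist (hk : 1 ≤ k) (i : Fin m) (J : RTree m) :
    glue k (.node (.leaf i) J) J = 0 := by
  by_cases h : J.deg = k
  · exact mk_eq_zero (Or.inr ⟨i, J, h, rfl⟩)
  · refine glue_of_deg_ne ?_
    simp only [RTree.deg]
    omega

theorem glue_square (hk : 1 ≤ k) (J t : RTree m) : glue k (.node J J) t = 0 := by
  cases t with
  | leaf i =>
    rw [glue_node, glue_comm, eq_neg_of_add_eq_zero_left (glue_skew J (.leaf i) J),
      glue_twist hk, neg_zero]
  | node a b =>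
    have h1 : glue k (.node (.node J a) b) J = - glue k (.node J a) (.node J b) := by
      rw [glue_node, glue_comm, eq_neg_of_add_eq_zero_left (glue_skew b J _), glue_comm]
    have h2 : glue k (.node a (.node J b)) J = glue k (.node J a) (.node J b) := by
      rw [eq_neg_of_add_eq_zero_left (glue_skew a (.node J b) J), glue_node, glue_comm,
        eq_neg_of_add_eq_zero_left (glue_skew a J _), neg_neg]
    have h3 := glue_jacobi (k := k) J a b J
    rw [h1, h2, sub_neg_eq_add, add_sub_cancel_right] at h3
    rw [glue_node, glue_comm, h3]

theorem isLieFunctional_glue (hk : 1 ≤ k) (t : RTree m) :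
    IsLieFunctional fun s => glue k s t := by
  have glue_node' (a b c : RTree m) : glue k (.node a b) c = - glue k b (.node a c) := by
    rw [eq_neg_of_add_eq_zero_left (glue_skew a b c), glue_node]
  refine ⟨fun c a b => ?_, fun c a b d => ?_, fun c a => ?_⟩
  · induction c generalizing t with
    | hole => exact glue_skew a b t
    | nodeL c r ih => simpa only [Ctx.fill, glue_node] using ih _
    | nodeR l c ih =>
      simp only [Ctx.fill, glue_node']
      rw [← neg_add, ih, neg_zero]
  · induction c generalizing t with
    | hole => exact glue_jacobi a b d t
    | nodeL c r ih => simpa only [Ctx.fill, glue_node] using ih _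
    | nodeR l c ih =>
      simp only [Ctx.fill, glue_node']
      rw [← neg_sub', ← neg_sub', ih, neg_zero]
  · induction c generalizing t with
    | hole => exact glue_square hk a t
    | nodeL c r ih => simpa only [Ctx.fill, glue_node] using ih _
    | nodeR l c ih =>
      simp only [Ctx.fill, glue_node']
      rw [ih, neg_zero]

theorem exists_pairing (hk : 1 ≤ k) :
    ∃ β : FreeLieAlgebra ℤ (Fin m) →+ FreeLieAlgebra ℤ (Fin m) →+ Tinfodd m k,
      (∀ s t : RTree m, β s.eval t.eval = glue k s t) ∧ (∀ a b, β a b = β b a) ∧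
        ∀ a b c, β ⁅a, b⁆ c = β a ⁅b, c⁆ := by
  obtain ⟨β, hβ⟩ := IsLieFunctional.exists_hom₂ (g := glue (m := m) k)
    (isLieFunctional_glue hk) (fun s => by
      simpa only [glue_comm _ s] using isLieFunctional_glue hk s)
  refine ⟨β, hβ, fun a b => ?_, fun a b c => ?_⟩
  · induction a using RTree.eval_induction with
    | zero => simp
    | neg x hx => simp [hx]
    | add x y hx hy => simp [hx, hy]
    | eval s =>
    induction b using RTree.eval_induction with
    | zero => simp
    | neg x hx => simp [hx]
    | add x y hx hy => simp [hx, hy]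
    | eval t => rw [hβ, hβ, glue_comm]
  · induction a using RTree.eval_induction with
    | zero => simp
    | neg x hx => simp [hx, -lie_skew]
    | add x y hx hy => simp [hx, hy]
    | eval r =>
    induction b using RTree.eval_induction with
    | zero => simp
    | neg x hx => simp [hx, -lie_skew]
    | add x y hx hy => simp [hx, hy]
    | eval s =>
    induction c using RTree.eval_induction with
    | zero => simp
    | neg x hx => simp [hx, -lie_skew]
    | add x y hx hy => simp [hx, hy]
    | eval t =>
      have h1 : ⁅r.eval, s.eval⁆ = (RTree.node r s).eval := rfl
      have h2 : ⁅s.eval, t.eval⁆ = (RTree.node s t).eval := rfl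
      rw [h1, h2, hβ, hβ, glue_node]

end Tinfodd

end TreePairing

section Reroot

variable {m : ℕ}

theorem LL.exists_projection (m n : ℕ) : ∃ q : FreeLieAlgebra ℤ (Fin m) →+ LL m n,
    ∀ t : RTree m, q t.eval = LLMk m n (FreeAbelianGroup.of t) :=
  (LL.isLieFunctional_mk n).exists_hom

theorem bracketLL_of_tmul (n : ℕ) (i : Fin m) (Y : LL m n) :
    bracketLL m n (FreeAbelianGroup.of i ⊗ₜ[ℤ] Y) = brLeafL m n i Y :=
  (TensorProduct.lift.tmul _ _).trans (DFunLike.congr_fun (FreeAbelianGroup.lift_apply_of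
    (fun i => (brLeafL m n i).toIntLinearMap) i) Y)

theorem brLeafL_mk (n : ℕ) (i : Fin m) (t : RTree m) :
    brLeafL m n i (LLMk m n (FreeAbelianGroup.of t)) =
      LLMk m (n + 1) (FreeAbelianGroup.of (.node (.leaf i) t)) :=
  congrArg (LLMk m (n + 1)) (FreeAbelianGroup.lift_apply_of _ t)

/-- `ρ` sends `(Y, r)` to the sum of the rerootings of `⟨Y, r⟩` at the leaves of `Y`. -/
structure IsReroot {n : ℕ} (ρ : FreeLieAlgebra ℤ (Fin m) →+ FreeLieAlgebra ℤ (Fin m) →+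
    FreeAbelianGroup (Fin m) ⊗[ℤ] LL m n) : Prop where
  of : ∀ i (t : RTree m), ρ (.of ℤ i) t.eval =
    FreeAbelianGroup.of i ⊗ₜ[ℤ] LLMk m n (FreeAbelianGroup.of t)
  lie : ∀ a b t, ρ ⁅a, b⁆ t = ρ a ⁅b, t⁆ - ρ b ⁅a, t⁆

theorem exists_isReroot (m n : ℕ) :
    ∃ ρ : FreeLieAlgebra ℤ (Fin m) →+ FreeLieAlgebra ℤ (Fin m) →+
      FreeAbelianGroup (Fin m) ⊗[ℤ] LL m n, IsReroot ρ := by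
  obtain ⟨q, hq⟩ := LL.exists_projection m n
  obtain ⟨ρ, ρ_of, ρ_lie⟩ := FreeLieAlgebra.exists_reroot fun i : Fin m =>
    (TensorProduct.mk ℤ (FreeAbelianGroup (Fin m)) (LL m n)
      (FreeAbelianGroup.of i)).toAddMonoidHom.comp q
  exact ⟨ρ, fun i t => by simp [ρ_of, hq], ρ_lie⟩

namespace IsReroot

variable {n : ℕ}
  {ρ : FreeLieAlgebra ℤ (Fin m) →+ FreeLieAlgebra ℤ (Fin m) →+
    FreeAbelianGroup (Fin m) ⊗[ℤ] LL m n}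

theorem sum_rerootList (hρ : IsReroot ρ) (s t : RTree m) :
    ((rerootList s t).map fun v =>
      FreeAbelianGroup.of v.1 ⊗ₜ[ℤ] LLMk m n (FreeAbelianGroup.of v.2)).sum =
      ρ s.eval t.eval := by
  induction s generalizing t with
  | leaf i => simp [rerootList, RTree.eval, hρ.of]
  | node a b ha hb =>
    rw [rerootList, List.map_append, List.sum_append, ha, hb, RTree.eval, RTree.eval, RTree.eval,
      hρ.lie, ← lie_skew a.eval t.eval, map_neg, sub_neg_eq_add]

theorem sum_pairReroots (hρ : IsReroot ρ) (p : RTree m × RTree m) :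
    ((pairReroots p).map fun v =>
      FreeAbelianGroup.of v.1 ⊗ₜ[ℤ] LLMk m n (FreeAbelianGroup.of v.2)).sum =
      ρ p.1.eval p.2.eval + ρ p.2.eval p.1.eval := by
  rw [pairReroots, List.map_append, List.sum_append, hρ.sum_rerootList,
    hρ.sum_rerootList]

theorem apply_twist (hρ : IsReroot ρ) (i : Fin m) (J : RTree m) :
    ρ (RTree.node (.leaf i) J).eval J.eval + ρ J.eval (RTree.node (.leaf i) J).eval = 0 := by
  rw [RTree.eval, hρ.lie, lie_self, map_zero, zero_sub, neg_add_cancel]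

theorem apply_of_deg_ne (hρ : IsReroot ρ) {s t : RTree m}
    (h : s.deg + t.deg ≠ n + 1) : ρ s.eval t.eval = 0 := by
  induction s generalizing t with
  | leaf i =>
    rw [RTree.eval, hρ.of, LL.mk_of_deg_ne, TensorProduct.tmul_zero]
    simp only [RTree.deg] at h
    omega
  | node a b ha hb =>
    simp only [RTree.deg] at h
    have h1 := ha (t := .node b t) (by simp only [RTree.deg]; omega)
    have h2 := hb (t := .node a t) (by simp only [RTree.deg]; omega)
    rw [RTree.eval] at h1 h2
    rw [RTree.eval, hρ.lie, h1, h2, sub_zero]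

theorem bracketLL_apply (hρ : IsReroot ρ)
    {q : FreeLieAlgebra ℤ (Fin m) →+ LL m (n + 1)}
    (hq : ∀ t : RTree m, q t.eval = LLMk m (n + 1) (FreeAbelianGroup.of t)) (s t : RTree m) :
    bracketLL m n (ρ s.eval t.eval) = LLMk m (n + 1) (FreeAbelianGroup.of (.node s t)) := by
  rw [← hq]
  induction s generalizing t with
  | leaf i => rw [RTree.eval, hρ.of, bracketLL_of_tmul, brLeafL_mk, hq]
  | node a b ha hb =>
    have h1 := ha (.node b t)
    have h2 := hb (.node a t)
    simp only [RTree.eval] at h1 h2 ⊢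
    rw [hρ.lie, map_sub, h1, h2, ← map_sub, lie_lie]

theorem exists_eta {k : ℕ} (hk : 1 ≤ k)
    {ρ : FreeLieAlgebra ℤ (Fin m) →+ FreeLieAlgebra ℤ (Fin m) →+
      FreeAbelianGroup (Fin m) ⊗[ℤ] LL m (2 * k)} (hρ : IsReroot ρ) :
    ∃ η : Tinfodd m k →+ FreeAbelianGroup (Fin m) ⊗[ℤ] LL m (2 * k),
      ∀ s t, η (Tinfodd.glue k s t) = ρ s.eval t.eval + ρ t.eval s.eval := by
  refine ⟨QuotientAddGroup.lift _ (FreeAbelianGroup.lift fun p : RTree m × RTree m =>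
    ρ p.1.eval p.2.eval + ρ p.2.eval p.1.eval) ?_,
    fun s t => FreeAbelianGroup.lift_apply_of _ (s, t)⟩
  rw [AddSubgroup.closure_le]
  rintro x (((((⟨p, hp, rfl⟩ | ⟨I, J, rfl⟩) | ⟨A, B, C, rfl⟩) | ⟨A, B, C, rfl⟩) |
    ⟨A, B, C, D, rfl⟩) | ⟨i, J, -, rfl⟩)
  · simp [hρ.apply_of_deg_ne (s := p.1) (t := p.2) (by omega),
      hρ.apply_of_deg_ne (s := p.2) (t := p.1) (by omega)]
  · simp [add_comm]
  · simp only [SetLike.mem_coe, AddMonoidHom.mem_ker, map_sub, FreeAbelianGroup.lift_apply_of,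
      RTree.eval, hρ.lie]
    rw [← lie_skew C.eval A.eval, ← lie_skew B.eval A.eval]
    simp only [map_neg]
    abel
  · simp only [SetLike.mem_coe, AddMonoidHom.mem_ker, map_add, FreeAbelianGroup.lift_apply_of,
      RTree.eval]
    rw [← lie_skew B.eval A.eval]
    simp only [map_neg, AddMonoidHom.neg_apply]
    abel
  · simp only [SetLike.mem_coe, AddMonoidHom.mem_ker, map_sub, FreeAbelianGroup.lift_apply_of,
      RTree.eval]
    rw [leibniz_lie]
    simp only [map_add, AddMonoidHom.add_apply]
    abel
  · simpa using hρ.apply_twist i J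

end IsReroot

end Reroot

section Tensor

variable {m : ℕ} {A L : Type*} [AddCommGroup A] [AddCommGroup L]

theorem exists_hom_tensor (u : Fin m → L →+ A) :
    ∃ σ : FreeAbelianGroup (Fin m) ⊗[ℤ] L →+ A,
      ∀ i Y, σ (FreeAbelianGroup.of i ⊗ₜ[ℤ] Y) = u i Y :=
  let T := TensorProduct.lift (FreeAbelianGroup.lift fun i =>
    (u i).toIntLinearMap).toIntLinearMap
  ⟨T.toAddMonoidHom, fun i Y => show T (FreeAbelianGroup.of i ⊗ₜ[ℤ] Y) = u i Y from
    (TensorProduct.lift.tmul _ _).trans (DFunLike.congr_fun (FreeAbelianGroup.lift_apply_of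
      (fun i => (u i).toIntLinearMap) i) Y)⟩

theorem LL.tensor_hom_ext {n : ℕ} {f g : FreeAbelianGroup (Fin m) ⊗[ℤ] LL m n →+ A}
    (h : ∀ i (t : RTree m), t.deg = n →
      f (FreeAbelianGroup.of i ⊗ₜ[ℤ] LLMk m n (FreeAbelianGroup.of t)) =
        g (FreeAbelianGroup.of i ⊗ₜ[ℤ] LLMk m n (FreeAbelianGroup.of t))) :
    f = g := by
  ext z
  induction z using TensorProduct.induction_on with
  | zero => simp
  | add x y hx hy => simp [hx, hy]
  | tmul v Y =>
    induction v using FreeAbelianGroup.induction_on with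
    | zero => simp
    | of i =>
      induction Y using LL.induction with
      | zero => simp
      | add x y hx hy => simp only [TensorProduct.tmul_add, map_add, hx, hy]
      | neg x hx => simp only [TensorProduct.tmul_neg, map_neg, hx]
      | mk t ht => exact h i t ht
    | neg i hi => simpa [TensorProduct.neg_tmul] using hi
    | add x y hx hy => simp only [TensorProduct.add_tmul, map_add, hx, hy]

end Tensor

theorem Tinfodd.hom_ext {m k : ℕ} {A : Type*} [AddCommGroup A] {f g : Tinfodd m k →+ A}
    (h : ∀ s t : RTree m, s.deg + t.deg = 2 * k - 1 + 2 → f (glue k s t) = g (glue k s t)) :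
    f = g := by
  have : ∀ s t, f (glue k s t) = g (glue k s t) := by
    intro s t
    by_cases hst : s.deg + t.deg = 2 * k - 1 + 2
    · exact h s t hst
    · rw [glue_of_deg_ne hst, map_zero, map_zero]
  ext ⟨s, t⟩
  exact this s t

/-- The primitive of the pairing on a free Lie ring with values in trees. -/
theorem Tinfodd.exists_cobounding {m k : ℕ}
    {β : FreeLieAlgebra ℤ (Fin m) →+ FreeLieAlgebra ℤ (Fin m) →+ Tinfodd m k}
    (hβ : ∀ s t : RTree m, β s.eval t.eval = glue k s t) (β_symm : ∀ a b, β a b = β b a)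
    (β_inv : ∀ a b c, β ⁅a, b⁆ c = β a ⁅b, c⁆) :
    ∃ θ : FreeLieAlgebra ℤ (Fin m) →+ FreeLieAlgebra ℤ (Fin m) →+ Tinfodd m k,
      (∀ a, θ a a = 0) ∧ ∀ a b c, θ ⁅a, b⁆ c + θ ⁅b, c⁆ a + θ ⁅c, a⁆ b = β ⁅a, b⁆ c := by
  refine FreeLieAlgebra.exists_cobounding (2 * k - 1 + 2) β β_symm β_inv ?_
  intro p q a b ha hb h
  obtain ⟨s, rfl, rfl⟩ := RTree.exists_eval_of_isMonomial ha
  obtain ⟨t, rfl, rfl⟩ := RTree.exists_eval_of_isMonomial hb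
  rw [hβ, glue_of_deg_ne h.ne']

namespace IsReroot

variable {m k : ℕ}
  {ρ : FreeLieAlgebra ℤ (Fin m) →+ FreeLieAlgebra ℤ (Fin m) →+
    FreeAbelianGroup (Fin m) ⊗[ℤ] LL m (2 * k)}
  {β θ : FreeLieAlgebra ℤ (Fin m) →+ FreeLieAlgebra ℤ (Fin m) →+ Tinfodd m k}
  {η : Tinfodd m k →+ FreeAbelianGroup (Fin m) ⊗[ℤ] LL m (2 * k)}
  {ι : LL m (2 * k) →+ FreeLieAlgebra ℤ (Fin m)}
  {σ : FreeAbelianGroup (Fin m) ⊗[ℤ] LL m (2 * k) →+ Tinfodd m k}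

theorem section_apply (hρ : IsReroot ρ)
    (β_inv : ∀ a b c, β ⁅a, b⁆ c = β a ⁅b, c⁆) (θ_self : ∀ a, θ a a = 0)
    (hθ : ∀ a b c, θ ⁅a, b⁆ c + θ ⁅b, c⁆ a + θ ⁅c, a⁆ b = β ⁅a, b⁆ c)
    (hι : ∀ t : RTree m, t.deg = 2 * k → ι (LLMk m (2 * k) (FreeAbelianGroup.of t)) = t.eval)
    (hσ : ∀ i Y, σ (FreeAbelianGroup.of i ⊗ₜ[ℤ] Y) =
      (1 - k : ℤ) • β (.of ℤ i) (ι Y) - (k : ℤ) • θ (.of ℤ i) (ι Y))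
    {s t : RTree m} (h : s.deg + t.deg = 2 * k + 1) :
    σ (ρ s.eval t.eval) =
      (s.deg - k : ℤ) • β s.eval t.eval - (k : ℤ) • θ s.eval t.eval := by
  induction s generalizing t with
  | leaf i =>
    simp only [RTree.deg] at h
    rw [RTree.eval, hρ.of, hσ, hι t (by omega)]
    simp [RTree.deg]
  | node a b ha hb =>
    simp only [RTree.deg] at h
    have h1 := ha (t := .node b t) (by simp only [RTree.deg]; omega)
    have h2 := hb (t := .node a t) (by simp only [RTree.deg]; omega)
    simp only [RTree.eval, RTree.deg] at h1 h2 ⊢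
    rw [hρ.lie, map_sub, h1, h2]
    have h3 := hθ a.eval b.eval t.eval
    have h4 : β b.eval ⁅a.eval, t.eval⁆ = - β a.eval ⁅b.eval, t.eval⁆ := by
      rw [← β_inv, ← β_inv, ← lie_skew, map_neg, AddMonoidHom.neg_apply]
    rw [FreeLieAlgebra.skew_of_apply_self θ_self ⁅b.eval, t.eval⁆,
      FreeLieAlgebra.skew_of_apply_self θ_self ⁅t.eval, a.eval⁆,
      ← lie_skew t.eval a.eval, map_neg, neg_neg, β_inv] at h3
    rw [h4, β_inv]
    push_cast
    linear_combination (norm := module) (k : ℤ) • h3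

theorem eta_section_apply (hρ : IsReroot ρ) (θ_self : ∀ a, θ a a = 0)
    (hθ : ∀ a b c, θ ⁅a, b⁆ c + θ ⁅b, c⁆ a + θ ⁅c, a⁆ b = β ⁅a, b⁆ c)
    (hη : ∀ a b, η (β a b) = ρ a b + ρ b a)
    (hι : ∀ t : RTree m, t.deg = 2 * k → ι (LLMk m (2 * k) (FreeAbelianGroup.of t)) = t.eval)
    (hσ : ∀ i Y, σ (FreeAbelianGroup.of i ⊗ₜ[ℤ] Y) =
      (1 - k : ℤ) • β (.of ℤ i) (ι Y) - (k : ℤ) • θ (.of ℤ i) (ι Y)) :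
    ∃ g : LL m (2 * k + 1) →+ FreeAbelianGroup (Fin m) ⊗[ℤ] LL m (2 * k),
      ∀ z, η (σ z) = z + g (bracketLL m (2 * k) z) := by
  obtain ⟨E, E_of, E_lie, E_eval⟩ := RTree.exists_derivation_eval (m := m)
  obtain ⟨f₁, hf₁⟩ := FreeLieAlgebra.exists_primitive_of_derivation hρ.lie E_lie
  obtain ⟨f₂, hf₂⟩ := FreeLieAlgebra.exists_primitive_of_cobounding hρ.lie
    (θ := (AddMonoidHom.compHom η).comp θ) (fun a => by simp [θ_self])
    (fun a b c => by
      simp only [AddMonoidHom.comp_apply, AddMonoidHom.compHom_apply_apply, ← map_add]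
      rw [hθ, hη])
  obtain ⟨ι', hι'⟩ := LL.exists_inclusion (m := m) (2 * k + 1)
  let g := (f₁ - k • f₂).comp ι'
  refine ⟨g, DFunLike.congr_fun (f := η.comp σ)
    (g := .id _ + g.comp (bracketLL m (2 * k)).toAddMonoidHom) (LL.tensor_hom_ext fun i t ht => ?_)⟩
  have hb : (bracketLL m (2 * k)).toAddMonoidHom
      (FreeAbelianGroup.of i ⊗ₜ[ℤ] LLMk m (2 * k) (FreeAbelianGroup.of t)) =
        LLMk m (2 * k + 1) (FreeAbelianGroup.of (.node (.leaf i) t)) :=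
    (bracketLL_of_tmul _ i _).trans (brLeafL_mk _ i t)
  have h1 := hf₁ (.of ℤ i) t.eval
  have h2 := hf₂ (.of ℤ i) t.eval
  have h3 : ι' (LLMk m (2 * k + 1) (FreeAbelianGroup.of (.node (.leaf i) t))) =
      ⁅FreeLieAlgebra.of ℤ i, t.eval⁆ := hι' _ (by simp only [RTree.deg]; omega)
  rw [E_of, E_eval, map_nsmul, ht, hρ.of] at h1
  simp only [AddMonoidHom.comp_apply, AddMonoidHom.compHom_apply_apply] at h2
  rw [hρ.of] at h2
  simp only [g, AddMonoidHom.comp_apply, AddMonoidHom.add_apply, AddMonoidHom.id_apply, hb,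
    AddMonoidHom.sub_apply, AddMonoidHom.smul_apply]
  rw [hσ, hι t ht, h3, h1, h2, map_sub, map_zsmul, map_zsmul, hη, hρ.of]
  generalize FreeAbelianGroup.of i ⊗ₜ[ℤ] LLMk m (2 * k) (FreeAbelianGroup.of t) = x
  module

end IsReroot

/-- For all `m,k ≥ 1`, the composite of `η'_{2k-1}` with the projection
`L'_1 ⊗ L'_{2k} → L_1 ⊗ L_{2k}` vanishes on every boundary-twist relator
`⟨(i,J),J⟩` (for `J` of order `k-1`), and the induced homomorphism
`η_{2k-1} : 𝒯^∞_{2k-1} → L_1 ⊗ L_{2k}` is injective with image exactly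
`D_{2k-1} = Ker(bracketLL m (2k))`; in particular `𝒯^∞_{2k-1} ≅ D_{2k-1}`. -/
theorem statement11 (m k : ℕ) (hm : 1 ≤ m) (hk : 1 ≤ k) :
    (∀ (i : Fin m) (J : RTree m), J.deg = k →
      ((pairReroots (RTree.node (RTree.leaf i) J, J)).map fun v =>
        (FreeAbelianGroup.of v.1) ⊗ₜ[ℤ]
          (LLMk m (2 * k) (FreeAbelianGroup.of v.2))).sum = 0) ∧
    ∃ η : Tinfodd m k →+ (FreeAbelianGroup (Fin m)) ⊗[ℤ] (LL m (2 * k)),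
      (∀ p : RTree m × RTree m, p.1.deg + p.2.deg = (2 * k - 1) + 2 →
        η (TinfoddMk m k (FreeAbelianGroup.of p)) =
          ((pairReroots p).map fun v =>
            (FreeAbelianGroup.of v.1) ⊗ₜ[ℤ]
              (LLMk m (2 * k) (FreeAbelianGroup.of v.2))).sum) ∧
      Function.Injective η ∧
      Set.range η = (LinearMap.ker (bracketLL m (2 * k)) :
        Set ((FreeAbelianGroup (Fin m)) ⊗[ℤ] (LL m (2 * k)))) := by
  obtain ⟨ρ, hρ⟩ := exists_isReroot m (2 * k)
  obtain ⟨β, hβ, β_symm, β_inv⟩ := Tinfodd.exists_pairing (m := m) hk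
  obtain ⟨θ, θ_self, hθ⟩ := Tinfodd.exists_cobounding hβ β_symm β_inv
  obtain ⟨η, η_glue⟩ := hρ.exists_eta hk
  obtain ⟨ι, hι⟩ := LL.exists_inclusion (m := m) (2 * k)
  obtain ⟨q, hq⟩ := LL.exists_projection m (2 * k + 1)
  have hη (a b) : η (β a b) = ρ a b + ρ b a := by
    induction a using RTree.eval_induction with
    | zero => simp
    | neg x hx =>
      simp only [map_neg, AddMonoidHom.neg_apply, hx]
      abel
    | add x y hx hy =>
      simp only [map_add, AddMonoidHom.add_apply, hx, hy]
      abel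
    | eval s =>
      induction b using RTree.eval_induction with
      | zero => simp
      | neg x hx =>
        simp only [map_neg, AddMonoidHom.neg_apply, hx]
        abel
      | add x y hx hy =>
        simp only [map_add, AddMonoidHom.add_apply, hx, hy]
        abel
      | eval t => rw [hβ, η_glue]
  obtain ⟨σ, hσ⟩ := exists_hom_tensor fun i : Fin m =>
    ((1 - k : ℤ) • β (.of ℤ i) - (k : ℤ) • θ (.of ℤ i)).comp ι
  replace hσ (i Y) : σ (FreeAbelianGroup.of i ⊗ₜ[ℤ] Y) =
      (1 - k : ℤ) • β (.of ℤ i) (ι Y) - (k : ℤ) • θ (.of ℤ i) (ι Y) := hσ i Y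
  obtain ⟨g, hg⟩ := hρ.eta_section_apply θ_self hθ hη hι hσ
  have σ_η : σ.comp η = .id _ := Tinfodd.hom_ext fun s t h => by
    have h' : s.deg + t.deg = 2 * k + 1 := by omega
    have hd : (s.deg : ℤ) + t.deg = 2 * k + 1 := by exact_mod_cast h'
    rw [AddMonoidHom.comp_apply, η_glue, map_add, hρ.section_apply β_inv θ_self hθ hι hσ h',
      hρ.section_apply β_inv θ_self hθ hι hσ ((add_comm _ _).trans h'), β_symm t.eval,
      FreeLieAlgebra.skew_of_apply_self θ_self t.eval, hβ, AddMonoidHom.id_apply,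
      ← one_smul ℤ (Tinfodd.glue k s t), smul_smul]
    linear_combination (norm := module) hd • Tinfodd.glue k s t
  have bracket_η : (bracketLL m (2 * k)).toAddMonoidHom.comp η = 0 :=
    Tinfodd.hom_ext fun s t _ => by
      have h1 : (bracketLL m (2 * k)).toAddMonoidHom (ρ s.eval t.eval) = _ :=
        hρ.bracketLL_apply hq s t
      have h2 : (bracketLL m (2 * k)).toAddMonoidHom (ρ t.eval s.eval) = _ :=
        hρ.bracketLL_apply hq t s
      rw [AddMonoidHom.comp_apply, η_glue, map_add, h1, h2]
      exact (LL.isLieFunctional_mk (2 * k + 1)).skew .hole s t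
  refine ⟨fun i J _ => (hρ.sum_pairReroots _).trans (hρ.apply_twist i J), η,
    fun p _ => (η_glue p.1 p.2).trans (hρ.sum_pairReroots p).symm,
    Function.LeftInverse.injective (g := σ) (DFunLike.congr_fun σ_η), Set.ext fun z => ⟨?_, ?_⟩⟩
  · rintro ⟨x, rfl⟩
    exact LinearMap.mem_ker.2 (DFunLike.congr_fun bracket_η x)
  · intro hz
    refine ⟨σ z, (hg z).trans ?_⟩
    rw [LinearMap.mem_ker.1 hz, map_zero, add_zero]
end

section
/- For every integer m ≥ 1, every k ≥ 0 and every rooted tree J of order k, one has Σ_v [X_{ℓ(v)}, T'_v(⟨J,J⟩)] = [J,J] in L'_{2k+2}, where the sum runs over the univalent vertices v of one fixed copy of J inside the order 2k unrooted tree ⟨J,J⟩, and T'_v(⟨J,J⟩) ∈ L'_{2k+1} is the rooted tree obtained from ⟨J,J⟩ by making v the root. -/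
open scoped TensorProduct

/-- Bracketing each leaf label of `t` with the tree `⟨t, r⟩` rerooted at that leaf, and summing
over the leaves of `t`, gives `[t, r]`. -/
theorem sum_bracket_rerootList {m : ℕ} (n : ℕ) (t r : RTree m) :
    LpMk m n (((rerootList t r).map fun v =>
        FreeAbelianGroup.of (RTree.node (RTree.leaf v.1) v.2)).sum)
      = LpMk m n (FreeAbelianGroup.of (RTree.node t r)) := by
  induction t generalizing r with
  | leaf i => simp [rerootList]
  | node a b iha ihb =>
    have hanti : LpMk m n (FreeAbelianGroup.of (RTree.node b (RTree.node a r)) +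
        FreeAbelianGroup.of (RTree.node b (RTree.node r a))) = 0 :=
      (QuotientAddGroup.eq_zero_iff _).2 <| AddSubgroup.subset_closure <|
        Or.inl (Or.inr ⟨Ctx.nodeR b Ctx.hole, a, r, rfl⟩)
    have hjac : LpMk m n (FreeAbelianGroup.of (RTree.node a (RTree.node b r)) -
        FreeAbelianGroup.of (RTree.node (RTree.node a b) r) -
        FreeAbelianGroup.of (RTree.node b (RTree.node a r))) = 0 :=
      (QuotientAddGroup.eq_zero_iff _).2 <| AddSubgroup.subset_closure <|
        Or.inr ⟨Ctx.hole, a, b, r, rfl⟩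
    rw [map_add] at hanti
    rw [map_sub, map_sub, sub_sub, sub_eq_zero] at hjac
    rw [rerootList, List.map_append, List.sum_append, map_add, iha, ihb, hjac, add_assoc, hanti,
      add_zero]

/-- For every `m ≥ 1`, `k ≥ 0` and every rooted tree `J` of order `k`
(degree `k+1`), one has `Σ_v [X_{ℓ(v)}, T'_v(⟨J,J⟩)] = [J,J]` in `L'_{2k+2}`,
where the sum runs over the univalent vertices `v` of one fixed copy of `J` inside
the order `2k` unrooted tree `⟨J,J⟩`. -/
theorem statement17 (m k : ℕ) (hm : 1 ≤ m) (J : RTree m) (hJ : J.deg = k + 1) :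
    LpMk m (2 * k + 2)
        (((rerootList J J).map fun v =>
          FreeAbelianGroup.of (RTree.node (RTree.leaf v.1) v.2)).sum)
      = LpMk m (2 * k + 2) (FreeAbelianGroup.of (RTree.node J J)) := by
  exact sum_bracket_rerootList _ J J
end
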